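/- For every vector v of the form v = 2π e_i or v = -2π e_i, where e₁ = (1,0,0), e₂ = (0,1,0), e₃ = (0,0,1), there exist t₀ > 0 and a solution X : ℝ → ℝ³ of the 1-1-1 ABC flow system such that X(t + t₀) = X(t) + v for every t ∈ ℝ. -/

import Mathlib

open Real Set Filter

/-- A solution of the 1-1-1 ABC flow system. -/
def IsABCSol (x y z : ℝ → ℝ) : Prop :=
  ∀ t : ℝ,
    HasDerivAt x (Real.sin (z t) + Real.cos (y t)) t ∧
    HasDerivAt y (Real.sin (x t) + Real.cos (z t)) t ∧
    HasDerivAt z (Real.sin (y t) + Real.cos (x t)) t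


/-- A bounded Lipschitz vector field on a Banach space has a global integral curve through
every point. -/
theorem exists_hasDerivAt_of_lipschitzWith_of_norm_le {E : Type*} [NormedAddCommGroup E]
    [NormedSpace ℝ E] [CompleteSpace E] {f : E → E} {K L : NNReal} (hf : LipschitzWith K f)
    (hL : ∀ x, ‖f x‖ ≤ L) (x₀ : E) :
    ∃ γ : ℝ → E, γ 0 = x₀ ∧ ∀ t, HasDerivAt γ (f (γ t)) t := by
  have local_curve : ∀ a : ℝ, 0 < a → ∃ γ : ℝ → E, γ 0 = x₀ ∧
      ∀ t ∈ Ioo (-a) a, HasDerivAt γ (f (γ t)) t := by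
    intro a ha
    have hpl : IsPicardLindelof (fun _ => f) (tmin := -a) (tmax := a)
        ⟨0, by constructor <;> linarith⟩ x₀ (L * a.toNNReal) 0 L K :=
      { lipschitzOnWith := fun _ _ => hf.lipschitzOnWith
        continuousOn := fun _ _ => continuousOn_const
        norm_le := fun _ _ x _ => hL x
        mul_max_le := by simp [ha.le] }
    obtain ⟨γ, h0, hγ⟩ := hpl.exists_eq_forall_mem_Icc_hasDerivWithinAt₀
    exact ⟨γ, h0, fun t ht =>
      (hγ t (Ioo_subset_Icc_self ht)).hasDerivAt (Icc_mem_nhds ht.1 ht.2)⟩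
  choose! γ hγ0 hγ using local_curve
  have agree : ∀ a b : ℝ, 0 < a → a ≤ b → EqOn (γ a) (γ b) (Ioo (-a) a) := by
    intro a b ha hab
    refine ODE_solution_unique_of_mem_Ioo (v := fun _ => f) (s := fun _ => univ) (t₀ := 0)
      (fun _ _ => hf.lipschitzOnWith) ⟨by linarith, ha⟩ (fun t ht => ⟨hγ a ha t ht, trivial⟩)
      (fun t ht => ⟨hγ b (ha.trans_le hab) t ⟨by linarith [ht.1], by linarith [ht.2]⟩, trivial⟩) ?_
    rw [hγ0 a ha, hγ0 b (ha.trans_le hab)]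
  have agree_diag : ∀ a : ℝ, 0 < a → EqOn (fun t => γ (|t| + 1) t) (γ a) (Ioo (-a) a) := by
    intro a ha t ht
    rcases le_total (|t| + 1) a with h | h
    · exact agree _ _ (by positivity) h (abs_lt.1 (lt_add_one _))
    · exact (agree _ _ ha h ht).symm
  refine ⟨fun t => γ (|t| + 1) t, hγ0 _ (by positivity), fun t => ?_⟩
  have hpos : 0 < |t| + 1 := by positivity
  have ht : t ∈ Ioo (-(|t| + 1)) (|t| + 1) := abs_lt.1 (lt_add_one _)
  exact (hγ _ hpos t ht).congr_of_eventuallyEq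
    ((agree_diag _ hpos).eventuallyEq_of_mem (Ioo_mem_nhds ht.1 ht.2))

/-- The vector field of the 1-1-1 ABC flow. -/
noncomputable def abcField (X : ℝ × ℝ × ℝ) : ℝ × ℝ × ℝ :=
  (sin X.2.2 + cos X.2.1, sin X.1 + cos X.2.2, sin X.2.1 + cos X.1)

theorem lipschitzWith_abcField : LipschitzWith 2 abcField := by
  have trig : ∀ {g h : ℝ × ℝ × ℝ → ℝ}, LipschitzWith 1 g → LipschitzWith 1 h →
      LipschitzWith 2 fun X => sin (g X) + cos (h X) := by
    intro g h hg hh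
    have := (lipschitzWith_sin.comp hg).add (lipschitzWith_cos.comp hh)
    norm_num at this
    exact this
  have h1 : LipschitzWith 1 fun X : ℝ × ℝ × ℝ => X.1 := LipschitzWith.prod_fst
  have h2 : LipschitzWith 1 fun X : ℝ × ℝ × ℝ => X.2.1 := by
    simpa using! LipschitzWith.prod_fst.comp (LipschitzWith.prod_snd (α := ℝ) (β := ℝ × ℝ))
  have h3 : LipschitzWith 1 fun X : ℝ × ℝ × ℝ => X.2.2 := by
    simpa using! LipschitzWith.prod_snd.comp (LipschitzWith.prod_snd (α := ℝ) (β := ℝ × ℝ))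
  simpa using! (trig h3 h2).prodMk ((trig h1 h3).prodMk (trig h2 h1))

theorem norm_abcField_le (X : ℝ × ℝ × ℝ) : ‖abcField X‖ ≤ 2 := by
  have trig : ∀ a b : ℝ, ‖sin a + cos b‖ ≤ 2 := fun a b =>
    (norm_add_le _ _).trans (by
      have := abs_sin_le_one a
      have := abs_cos_le_one b
      simp only [Real.norm_eq_abs]
      linarith)
  exact norm_prod_le_iff.2 ⟨trig _ _, norm_prod_le_iff.2 ⟨trig _ _, trig _ _⟩⟩

/-- The ABC system in the coordinates `s = x + π / 4`, `p = (y + z - π / 2) / 2`,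
`q = (z - y - π / 2) / 2`. -/
def IsReducedSol (s p q : ℝ → ℝ) : Prop :=
  ∀ t : ℝ,
    HasDerivAt s (2 * cos (p t) * cos (q t)) t ∧
    HasDerivAt p (√2 / 2 * sin (s t) - cos (p t) * sin (q t)) t ∧
    HasDerivAt q (√2 / 2 * cos (s t) + sin (p t) * cos (q t)) t

theorem le_of_hasDerivAt_nonneg {f f' : ℝ → ℝ} {T : ℝ} (hf : ∀ t, HasDerivAt f (f' t) t)
    (hf' : ∀ t ∈ Icc 0 T, 0 ≤ f' t) {t : ℝ} (ht : t ∈ Icc 0 T) : f 0 ≤ f t :=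
  monotoneOn_of_hasDerivWithinAt_nonneg (convex_Icc 0 T)
    (fun t _ => (hf t).continuousAt.continuousWithinAt)
    (fun t _ => (hf t).hasDerivWithinAt) (fun t ht => hf' t (interior_subset ht))
    ⟨le_rfl, ht.1.trans ht.2⟩ ht ht.1

theorem half_sqrt_two_bounds : 0.7071 < √2 / 2 ∧ √2 / 2 < 0.70711 := by
  constructor
  · have : (1.4142 : ℝ) < √2 := Real.lt_sqrt_of_sq_lt (by norm_num)
    linarith
  · have : √2 < (1.41422 : ℝ) := (Real.sqrt_lt' (by norm_num)).2 (by norm_num)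
    linarith

theorem le_cos_of_abs_le {x a : ℝ} (hx : |x| ≤ a) : 1 - a ^ 2 / 2 ≤ cos x := by
  have h1 := one_sub_sq_div_two_le_cos (x := x)
  have h2 : x ^ 2 ≤ a ^ 2 := sq_le_sq' (abs_le.1 hx).1 (abs_le.1 hx).2
  linarith

/-- The box in which the trajectories of the shooting argument are followed. -/
def InBox (s p q : ℝ) : Prop :=
  s ≤ π / 2 ∧ -0.51 ≤ p ∧ p ≤ 0 ∧ |q| ≤ 1 / 2

theorem InBox.cos_p {s p q : ℝ} (h : InBox s p q) : 0.8699 ≤ cos p := by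
  have := le_cos_of_abs_le (x := p) (a := 0.51) (abs_le.2 ⟨h.2.1, by linarith [h.2.2.1]⟩)
  linarith

theorem InBox.cos_q {s p q : ℝ} (h : InBox s p q) : 0.875 ≤ cos q := by
  have := le_cos_of_abs_le h.2.2.2
  linarith

namespace IsReducedSol

variable {s p q : ℝ → ℝ} {T : ℝ}

theorem le_s (h : IsReducedSol s p q) (hs : s 0 = 0)
    (hbox : ∀ t ∈ Icc 0 T, InBox (s t) (p t) (q t)) {t : ℝ} (ht : t ∈ Icc 0 T) : t ≤ s t := by
  have := le_of_hasDerivAt_nonneg (f := fun t => s t - t)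
    (fun t => (h t).1.sub (hasDerivAt_id t)) (T := T) (fun t ht => by
      have h1 := (hbox t ht).cos_p
      have h2 := (hbox t ht).cos_q
      nlinarith) ht
  simp only [hs] at this
  linarith

theorem sin_s_nonneg (h : IsReducedSol s p q) (hs : s 0 = 0)
    (hbox : ∀ t ∈ Icc 0 T, InBox (s t) (p t) (q t)) {t : ℝ} (ht : t ∈ Icc 0 T) :
    0 ≤ sin (s t) :=
  sin_nonneg_of_nonneg_of_le_pi (ht.1.trans (h.le_s hs hbox ht))
    (by linarith [(hbox t ht).1, pi_pos])

theorem cos_s_nonneg (h : IsReducedSol s p q) (hs : s 0 = 0)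
    (hbox : ∀ t ∈ Icc 0 T, InBox (s t) (p t) (q t)) {t : ℝ} (ht : t ∈ Icc 0 T) :
    0 ≤ cos (s t) :=
  cos_nonneg_of_mem_Icc
    ⟨by linarith [pi_pos, ht.1, h.le_s hs hbox ht], (hbox t ht).1⟩

theorem sin_q_le (h : IsReducedSol s p q) (hs : s 0 = 0) (hq : q 0 = 0)
    (hbox : ∀ t ∈ Icc 0 T, InBox (s t) (p t) (q t)) {t : ℝ} (ht : t ∈ Icc 0 T) :
    sin (q t) ≤ 0.41 * sin (s t) := by
  have := le_of_hasDerivAt_nonneg (f := fun t => 0.41 * sin (s t) - sin (q t))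
    (fun t => ((h t).1.sin.const_mul 0.41).sub (h t).2.2.sin) (T := T) (fun t ht => by
      have h1 := (hbox t ht).cos_p
      have h2 := (hbox t ht).cos_q
      have h3 := h.cos_s_nonneg hs hbox ht
      have h4 : sin (p t) ≤ 0 := sin_nonpos_of_nonpos_of_neg_pi_le (hbox t ht).2.2.1
        (by linarith [(hbox t ht).2.1, pi_gt_three])
      have h5 := half_sqrt_two_bounds.2
      have h6 : 0 ≤ 0.82 * cos (p t) - √2 / 2 := by linarith
      have h7 : 0 ≤ cos (s t) * cos (q t) := by positivity
      nlinarith [mul_nonneg h7 h6, mul_nonneg (neg_nonneg.2 h4) (sq_nonneg (cos (q t)))]) ht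
  simp only [hs, hq, sin_zero] at this
  linarith

theorem p_zero_le (h : IsReducedSol s p q) (hs : s 0 = 0) (hq : q 0 = 0)
    (hbox : ∀ t ∈ Icc 0 T, InBox (s t) (p t) (q t)) {t : ℝ} (ht : t ∈ Icc 0 T) :
    p 0 ≤ p t :=
  le_of_hasDerivAt_nonneg (fun t => (h t).2.1) (T := T) (fun t ht => by
    have h1 := (hbox t ht).cos_p
    have h2 := h.sin_q_le hs hq hbox ht
    have h3 := h.sin_s_nonneg hs hbox ht
    have h4 := half_sqrt_two_bounds.1
    nlinarith [cos_le_one (p t), mul_le_mul_of_nonneg_left h2 (by linarith : 0 ≤ cos (p t)),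
      mul_nonneg h3 (sub_nonneg.2 (cos_le_one (p t)))]) ht

theorem le_q (h : IsReducedSol s p q) (hs : s 0 = 0) (hq : q 0 = 0) (hp : -1 / 2 ≤ p 0)
    (hbox : ∀ t ∈ Icc 0 T, InBox (s t) (p t) (q t)) {t : ℝ} (ht : t ∈ Icc 0 T) :
    -0.096 * sin (s t) ≤ q t := by
  have := le_of_hasDerivAt_nonneg (f := fun t => q t - √2 / 4 * sin (s t) + 2 / 7 * s t)
    (fun t => ((h t).2.2.sub ((h t).1.sin.const_mul (√2 / 4))).add ((h t).1.const_mul (2 / 7)))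
    (T := T) (fun t ht => by
      have hp' := hp.trans (h.p_zero_le hs hq hbox ht)
      have hp0 := (hbox t ht).2.2.1
      have h1 := le_cos_of_abs_le (x := p t) (a := 1 / 2) (abs_le.2 ⟨by linarith, by linarith⟩)
      have h2 := (hbox t ht).cos_q
      have h3 := h.cos_s_nonneg hs hbox ht
      have h4 : -(1 / 2) ≤ sin (p t) := by
        have := sin_le (x := -p t) (by linarith)
        rw [sin_neg] at this
        linarith
      have h5 : cos (p t) * cos (q t) ≤ 1 :=
        mul_le_one₀ (cos_le_one _) (by linarith) (cos_le_one _)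
      have h6 : 0 ≤ sin (p t) + 4 / 7 * cos (p t) := by linarith
      have h7 : 0 ≤ √2 / 2 * cos (s t) := by positivity
      nlinarith [mul_nonneg h7 (sub_nonneg.2 h5), mul_nonneg h6 (by linarith : 0 ≤ cos (q t))]) ht
  simp only [hs, hq, sin_zero] at this
  have h1 := mul_le_sin (ht.1.trans (h.le_s hs hbox ht)) (hbox t ht).1
  have h2 : s t ≤ π / 2 * sin (s t) := by
    have := mul_le_mul_of_nonneg_left h1 (by positivity : 0 ≤ π / 2)
    field_simp at this ⊢
    linarith
  have h3 := half_sqrt_two_bounds.1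
  have h4 := pi_lt_d4
  have h5 := h.sin_s_nonneg hs hbox ht
  have h6 : 0 ≤ 0.096 + √2 / 4 - π / 7 := by linarith
  nlinarith [mul_nonneg h6 h5]

theorem p_le (h : IsReducedSol s p q) (hs : s 0 = 0) (hq : q 0 = 0) (hp : p 0 = -1 / 2)
    (hbox : ∀ t ∈ Icc 0 T, InBox (s t) (p t) (q t)) {t : ℝ} (ht : t ∈ Icc 0 T) :
    p t < 0 := by
  have := le_of_hasDerivAt_nonneg (f := fun t => -(0.4975 * cos (s t)) - p t)
    (fun t => ((h t).1.cos.const_mul 0.4975).neg.sub (h t).2.1) (T := T) (fun t ht => by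
      have hp' := hp.symm.le.trans (h.p_zero_le hs hq hbox ht)
      have hp0 := (hbox t ht).2.2.1
      have h1 := le_cos_of_abs_le (x := p t) (a := 1 / 2) (abs_le.2 ⟨by linarith, by linarith⟩)
      have h2 := (hbox t ht).cos_q
      have h3 := h.sin_s_nonneg hs hbox ht
      have h4 := h.le_q hs hq hp.symm.le hbox ht
      have h5 := half_sqrt_two_bounds.2
      have h6 := h.sin_q_le hs hq hbox ht
      have h7 : -0.096 * sin (s t) ≤ sin (q t) := by
        rcases le_total (q t) 0 with hq' | hq'
        · have := sin_le (x := -q t) (by linarith)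
          rw [sin_neg] at this
          linarith
        · have := sin_nonneg_of_nonneg_of_le_pi hq'
            (by linarith [(abs_le.1 (hbox t ht).2.2.2).2, pi_gt_three])
          linarith
      have h8 : 0.912 ≤ cos (q t) := by
        have h9 := sin_sq_add_cos_sq (q t)
        have h10 := sin_le_one (s t)
        nlinarith
      have h11 : 0.875 * (0.995 * 0.912 - 0.096) ≤ cos (p t) * (0.995 * cos (q t) - 0.096) :=
        mul_le_mul (by linarith) (by linarith) (by norm_num) (by linarith)
      have h12 : 0 ≤ cos (p t) * (0.995 * cos (q t) - 0.096) - √2 / 2 := by linarith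
      nlinarith [mul_nonneg h3 h12, mul_nonneg (by linarith : 0 ≤ cos (p t))
        (sub_nonneg.2 h7)]) ht
  simp only [hs, hp, cos_zero] at this
  linarith [h.cos_s_nonneg hs hbox ht]

end IsReducedSol

theorem HasDerivAt.eventually_nhdsGT_lt {f : ℝ → ℝ} {f' x : ℝ} (hf : HasDerivAt f f' x)
    (hf' : 0 < f') : ∀ᶠ t in nhdsWithin x (Ioi x), f x < f t := by
  have hslope : ∀ᶠ t in nhdsWithin x (Ioi x), 0 < slope f x t :=
    ((hasDerivAt_iff_tendsto_slope.1 hf).mono_left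
      (nhdsWithin_mono x fun _ ht => ne_of_gt ht)).eventually (lt_mem_nhds hf')
  filter_upwards [hslope, self_mem_nhdsWithin] with t ht hxt
  rw [slope_def_field] at ht
  have := (div_pos_iff_of_pos_right (sub_pos.2 (mem_Ioi.1 hxt))).1 ht
  linarith

/-- The curve `f` rises above `c` at some nonnegative time up to which `g` stays below `d`. -/
def CrossesFirst (f g : ℝ → ℝ) (c d : ℝ) : Prop :=
  ∃ t ≥ 0, c < f t ∧ ∀ τ ∈ Icc 0 t, g τ < d

theorem crossesFirst_of_eventually {f g : ℝ → ℝ} {c d T : ℝ} (hT : 0 ≤ T)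
    (hf : ∀ᶠ t in nhdsWithin T (Ioi T), c < f t) (hg : Continuous g)
    (hgd : ∀ t ∈ Icc 0 T, g t < d) : CrossesFirst f g c d := by
  obtain ⟨δ, hδ, hgδ⟩ := Metric.eventually_nhds_iff.1
    (hg.continuousAt.eventually (gt_mem_nhds (hgd T ⟨hT, le_rfl⟩)))
  obtain ⟨t, hft, htT, htδ⟩ :=
    (hf.and (Ioo_mem_nhdsGT (lt_add_of_pos_right T hδ))).exists
  refine ⟨t, hT.trans htT.le, hft, fun τ hτ => ?_⟩
  rcases le_or_gt τ T with h | h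
  · exact hgd τ ⟨hτ.1, h⟩
  · refine hgδ ?_
    rw [Real.dist_eq, abs_of_pos (sub_pos.2 h)]
    linarith [hτ.2]

theorem isOpen_setOf_crossesFirst {F G : ℝ → ℝ → ℝ} (c d : ℝ)
    (hF : ∀ a T, TendstoUniformlyOn F (F a) (nhds a) (Icc 0 T))
    (hG : ∀ a T, TendstoUniformlyOn G (G a) (nhds a) (Icc 0 T))
    (hGc : ∀ a, Continuous (G a)) : IsOpen {a | CrossesFirst (F a) (G a) c d} := by
  rw [isOpen_iff_eventually]
  rintro a ⟨t, ht0, hft, hgt⟩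
  obtain ⟨m, hm, hmax⟩ := isCompact_Icc.exists_isMaxOn (nonempty_Icc.2 ht0) (hGc a).continuousOn
  filter_upwards [Metric.tendstoUniformlyOn_iff.1 (hF a t) _ (sub_pos.2 hft),
    Metric.tendstoUniformlyOn_iff.1 (hG a t) _ (sub_pos.2 (hgt m hm))] with b hb1 hb2
  refine ⟨t, ht0, ?_, fun τ hτ => ?_⟩
  · have := hb1 t ⟨ht0, le_rfl⟩
    rw [Real.dist_eq] at this
    linarith [(abs_lt.1 this).2]
  · have h1 := hb2 τ hτ
    have h2 : G a τ ≤ G a m := hmax hτ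
    rw [Real.dist_eq] at h1
    linarith [(abs_lt.1 h1).1]

namespace IsReducedSol

variable {s p q : ℝ → ℝ}

theorem continuous_s (h : IsReducedSol s p q) : Continuous s :=
  continuous_iff_continuousAt.2 fun t => (h t).1.continuousAt

theorem continuous_p (h : IsReducedSol s p q) : Continuous p :=
  continuous_iff_continuousAt.2 fun t => (h t).2.1.continuousAt

theorem continuous_q (h : IsReducedSol s p q) : Continuous q :=
  continuous_iff_continuousAt.2 fun t => (h t).2.2.continuousAt

theorem exists_exit (h : IsReducedSol s p q) (hs : s 0 = 0) (hq : q 0 = 0) (hp : -1 / 2 ≤ p 0)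
    (hp0 : p 0 < 0) :
    ∃ T > 0, (∀ t ∈ Icc 0 T, InBox (s t) (p t) (q t)) ∧
      (∀ t ∈ Ico 0 T, p t < 0 ∧ s t < π / 2) ∧ (p T = 0 ∨ s T = π / 2) := by
  have hsc := h.continuous_s
  have hpc := h.continuous_p
  have hqc := h.continuous_q
  set C : Set ℝ := {t | 0 ≤ t ∧ (π / 2 ≤ s t ∨ p t ≤ -0.51 ∨ 0 ≤ p t ∨ 1 / 2 ≤ |q t|)} with hC
  have hC_closed : IsClosed C :=
    (isClosed_le continuous_const continuous_id).inter
      ((isClosed_le continuous_const hsc).union ((isClosed_le hpc continuous_const).union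
        ((isClosed_le continuous_const hpc).union (isClosed_le continuous_const hqc.abs))))
  have hC_bdd : BddBelow C := ⟨0, fun t ht => ht.1⟩
  have hC_compl : ∀ t, 0 ≤ t → t ∉ C →
      s t < π / 2 ∧ -0.51 < p t ∧ p t < 0 ∧ |q t| < 1 / 2 := by
    intro t ht htC
    simp only [hC, mem_ofPred_eq, ht, true_and, not_or, not_le] at htC
    exact htC
  have hC_ne : C.Nonempty := by
    by_contra hne
    have hbox : ∀ t ∈ Icc (0 : ℝ) 2, InBox (s t) (p t) (q t) := fun t ht => by
      obtain ⟨h1, h2, h3, h4⟩ := hC_compl t ht.1 fun htC => hne ⟨t, htC⟩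
      exact ⟨h1.le, h2.le, h3.le, h4.le⟩
    have h2 : (2 : ℝ) ∈ Icc (0 : ℝ) 2 := ⟨by norm_num, le_rfl⟩
    linarith [h.le_s hs hbox h2, (hbox 2 h2).1, pi_lt_d2]
  have hT_mem := hC_closed.csInf_mem hC_ne hC_bdd
  set T := sInf C
  have hT_pos : 0 < T := by
    refine hT_mem.1.lt_of_ne fun h0 => ?_
    have := hT_mem.2
    rw [← h0, hs, hq, abs_zero] at this
    rcases this with h1 | h1 | h1 | h1 <;> linarith [pi_pos]
  have hbefore : ∀ t ∈ Ico 0 T, s t < π / 2 ∧ -0.51 < p t ∧ p t < 0 ∧ |q t| < 1 / 2 :=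
    fun t ht => hC_compl t ht.1 (notMem_of_lt_csInf ht.2 hC_bdd)
  have hbox : ∀ t ∈ Icc 0 T, InBox (s t) (p t) (q t) := by
    have hclosed : IsClosed {t | InBox (s t) (p t) (q t)} :=
      (isClosed_le hsc continuous_const).inter ((isClosed_le continuous_const hpc).inter
        ((isClosed_le hpc continuous_const).inter (isClosed_le hqc.abs continuous_const)))
    intro t ht
    rw [← closure_Ico hT_pos.ne] at ht
    refine closure_minimal (fun τ hτ => ?_) hclosed ht
    obtain ⟨h1, h2, h3, h4⟩ := hbefore τ hτ
    exact ⟨h1.le, h2.le, h3.le, h4.le⟩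
  refine ⟨T, hT_pos, hbox, fun t ht => ⟨(hbefore t ht).2.2.1, (hbefore t ht).1⟩, ?_⟩
  have hT : T ∈ Icc 0 T := ⟨hT_pos.le, le_rfl⟩
  have hsin := sin_le_one (s T)
  rcases hT_mem.2 with h1 | h1 | h1 | h1
  · exact Or.inr (le_antisymm (hbox T hT).1 h1)
  · linarith [h.p_zero_le hs hq hbox hT]
  · exact Or.inl (le_antisymm (hbox T hT).2.2.1 h1)
  · have hle := h.sin_q_le hs hq hbox hT
    have hge := h.le_q hs hq hp hbox hT
    rcases le_abs.1 h1 with h2 | h2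
    · have h3 : q T = 1 / 2 := le_antisymm (abs_le.1 (hbox T hT).2.2.2).2 h2
      have h4 := sin_gt_sub_cube (x := 1 / 2) (by norm_num)
      rw [h3] at hle
      linarith
    · linarith

/-- A trajectory issuing from the symmetry line `s = q = 0` with `p ∈ [-1/2, 0)` meets the line
`s = π / 2`, `p = 0`, unless it crosses one of `p = 0`, `s = π / 2` strictly first. -/
theorem exists_meets_or_crossesFirst (h : IsReducedSol s p q) (hs : s 0 = 0) (hq : q 0 = 0)
    (hp : -1 / 2 ≤ p 0) (hp0 : p 0 < 0) :
    (∃ T > 0, s T = π / 2 ∧ p T = 0) ∨ CrossesFirst p s 0 (π / 2) ∨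
      CrossesFirst s p (π / 2) 0 := by
  obtain ⟨T, hT_pos, hbox, hbefore, hexit⟩ := h.exists_exit hs hq hp hp0
  have hT : T ∈ Icc 0 T := ⟨hT_pos.le, le_rfl⟩
  by_cases hsT : s T = π / 2
  · by_cases hpT : p T = 0
    · exact Or.inl ⟨T, hT_pos, hsT, hpT⟩
    · refine Or.inr (Or.inr (crossesFirst_of_eventually hT_pos.le ?_ h.continuous_p ?_))
      · have h1 := (hbox T hT).cos_p
        have h2 := (hbox T hT).cos_q
        rw [← hsT]
        exact (h T).1.eventually_nhdsGT_lt (by nlinarith)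
      · intro t ht
        rcases ht.2.lt_or_eq with hlt | rfl
        · exact (hbefore t ⟨ht.1, hlt⟩).1
        · exact lt_of_le_of_ne (hbox t hT).2.2.1 hpT
  · have hpT : p T = 0 := hexit.resolve_right hsT
    have hsT' : s T < π / 2 := lt_of_le_of_ne (hbox T hT).1 hsT
    refine Or.inr (Or.inl (crossesFirst_of_eventually hT_pos.le ?_ h.continuous_s ?_))
    · have hpos : 0 < √2 / 2 * sin (s T) - cos (p T) * sin (q T) := by
        have h1 : 0 < sin (s T) := sin_pos_of_pos_of_lt_pi
          (hT_pos.trans_le (h.le_s hs hbox hT)) (by linarith [pi_pos])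
        have h2 := h.sin_q_le hs hq hbox hT
        rw [hpT, cos_zero]
        nlinarith [half_sqrt_two_bounds.1]
      have := (h T).2.1.eventually_nhdsGT_lt hpos
      rwa [hpT] at this
    · intro t ht
      rcases ht.2.lt_or_eq with hlt | rfl
      · exact (hbefore t ⟨ht.1, hlt⟩).2
      · exact hsT'

theorem crossesFirst_of_p_zero_eq_neg_half (h : IsReducedSol s p q) (hs : s 0 = 0) (hq : q 0 = 0)
    (hp : p 0 = -1 / 2) : CrossesFirst s p (π / 2) 0 := by
  obtain ⟨T, hT_pos, hbox, -, hexit⟩ := h.exists_exit hs hq hp.symm.le (by linarith)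
  have hT : T ∈ Icc 0 T := ⟨hT_pos.le, le_rfl⟩
  have hsT : s T = π / 2 := hexit.resolve_left (h.p_le hs hq hp hbox hT).ne
  refine crossesFirst_of_eventually hT_pos.le ?_ h.continuous_p
    fun t ht => h.p_le hs hq hp hbox ht
  have h1 := (hbox T hT).cos_p
  have h2 := (hbox T hT).cos_q
  rw [← hsT]
  exact (h T).1.eventually_nhdsGT_lt (by nlinarith)

theorem crossesFirst_of_p_zero_eq_zero (h : IsReducedSol s p q) (hs : s 0 = 0) (hq : q 0 = 0)
    (hp : p 0 = 0) : CrossesFirst p s 0 (π / 2) := by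
  refine crossesFirst_of_eventually le_rfl ?_ h.continuous_s fun t ht => by
    rw [le_antisymm ht.2 ht.1, hs]
    positivity
  have hderiv : HasDerivAt (fun t => √2 / 2 * sin (s t) - cos (p t) * sin (q t)) (√2 / 2) 0 := by
    refine (((h 0).1.sin.const_mul (√2 / 2)).sub
      ((h 0).2.1.cos.mul (h 0).2.2.sin)).congr_deriv ?_
    simp only [hs, hp, hq, sin_zero, cos_zero]
    ring
  have hev := hderiv.eventually_nhdsGT_lt (by positivity)
  simp only [hs, hp, hq, sin_zero, mul_zero, sub_zero] at hev
  obtain ⟨δ, hδ, hδpos⟩ := (mem_nhdsGT_iff_exists_Ioo_subset).1 hev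
  filter_upwards [Ioo_mem_nhdsGT hδ] with t ht
  rw [← hp]
  refine strictMonoOn_of_deriv_pos (convex_Icc 0 t) h.continuous_p.continuousOn ?_
    ⟨le_rfl, ht.1.le⟩ ⟨ht.1.le, le_rfl⟩ ht.1
  intro τ hτ
  rw [interior_Icc] at hτ
  rw [(h τ).2.1.deriv]
  exact hδpos ⟨hτ.1, hτ.2.trans ht.2⟩

end IsReducedSol

/-- A continuous family of trajectories issuing from the line `s = q = 0` contains one that meets
the line `s = π / 2`, `p = 0`. -/
theorem exists_reducedSol_meets {s p q : ℝ → ℝ → ℝ} (h : ∀ a, IsReducedSol (s a) (p a) (q a))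
    (hs : ∀ a, s a 0 = 0) (hp : ∀ a, p a 0 = a) (hq : ∀ a, q a 0 = 0)
    (hs' : ∀ a T, TendstoUniformlyOn s (s a) (nhds a) (Icc 0 T))
    (hp' : ∀ a T, TendstoUniformlyOn p (p a) (nhds a) (Icc 0 T)) :
    ∃ a, ∃ T > 0, s a T = π / 2 ∧ p a T = 0 := by
  by_contra! hne
  have hU := isOpen_setOf_crossesFirst 0 (π / 2) hp' hs' fun a => (h a).continuous_s
  have hV := isOpen_setOf_crossesFirst (π / 2) 0 hs' hp' fun a => (h a).continuous_p
  have hzero : CrossesFirst (p 0) (s 0) 0 (π / 2) :=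
    (h 0).crossesFirst_of_p_zero_eq_zero (hs 0) (hq 0) (hp 0)
  obtain ⟨a, -, ⟨t₁, h₁, hp₁, hs₁⟩, t₂, h₂, hs₂, hp₂⟩ := isPreconnected_Icc
    (a := (-1 / 2 : ℝ)) (b := 0) _ _ hU hV
    (fun a ha => by
      rcases ha.2.lt_or_eq with hlt | rfl
      · rcases (h a).exists_meets_or_crossesFirst (hs a) (hq a) (by rw [hp]; exact ha.1)
          (by rw [hp]; exact hlt) with ⟨T, hT, hsT, hpT⟩ | hc
        · exact absurd hpT (hne a T hT hsT)
        · exact hc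
      · exact Or.inl hzero)
    ⟨0, ⟨by norm_num, le_rfl⟩, hzero⟩
    ⟨-1 / 2, ⟨le_rfl, by norm_num⟩,
      (h _).crossesFirst_of_p_zero_eq_neg_half (hs _) (hq _) (hp _)⟩
  rcases le_total t₁ t₂ with hle | hle
  · exact (hp₂ t₁ ⟨h₁, hle⟩).not_gt hp₁
  · exact (hs₁ t₂ ⟨h₂, hle⟩).not_gt hs₂

namespace IsABCSol

variable {x y z : ℝ → ℝ}

theorem hasDerivAt_prodMk (h : IsABCSol x y z) (t : ℝ) :
    HasDerivAt (fun t => (x t, y t, z t)) (abcField (x t, y t, z t)) t :=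
  (h t).1.prodMk ((h t).2.1.prodMk (h t).2.2)

theorem of_hasDerivAt {γ : ℝ → ℝ × ℝ × ℝ} (h : ∀ t, HasDerivAt γ (abcField (γ t)) t) :
    IsABCSol (fun t => (γ t).1) (fun t => (γ t).2.1) (fun t => (γ t).2.2) :=
  fun t => ⟨(h t).fst, (h t).snd.fst, (h t).snd.snd⟩

theorem eq_of_eq_at {x' y' z' : ℝ → ℝ} (h : IsABCSol x y z) (h' : IsABCSol x' y' z') {t₀ : ℝ}
    (hx : x t₀ = x' t₀) (hy : y t₀ = y' t₀) (hz : z t₀ = z' t₀) (t : ℝ) :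
    x t = x' t ∧ y t = y' t ∧ z t = z' t := by
  have := congrFun (ODE_solution_unique_univ (v := fun _ => abcField) (s := fun _ => univ)
    (t₀ := t₀) (fun _ => lipschitzWith_abcField.lipschitzOnWith)
    (fun t => ⟨h.hasDerivAt_prodMk t, trivial⟩)
    (fun t => ⟨h'.hasDerivAt_prodMk t, trivial⟩) (by simp [hx, hy, hz])) t
  simpa using this

theorem cycle (h : IsABCSol x y z) : IsABCSol y z x :=
  fun t => ⟨(h t).2.1, (h t).2.2, (h t).1⟩

/-- The symmetry of the flow whose linear part is the half turn about the `z`-axis. -/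
theorem half_turn (h : IsABCSol x y z) :
    IsABCSol (fun t => -x t) (fun t => π - y t) (fun t => z t + π) := fun t =>
  ⟨(h t).1.neg.congr_deriv (by rw [sin_add_pi, cos_pi_sub]; ring),
    ((h t).2.1.const_sub π).congr_deriv (by rw [sin_neg, cos_add_pi]; ring),
    ((h t).2.2.add_const π).congr_deriv (by rw [sin_pi_sub, cos_neg])⟩

/-- The reversor of the flow fixing the line `x = -π / 4`, `z = y + π / 2`. -/
theorem reverse_sub (h : IsABCSol x y z) (c : ℝ) :
    IsABCSol (fun t => -x (c - t) - π / 2) (fun t => z (c - t) - π / 2)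
      (fun t => y (c - t) + π / 2) := fun t =>
  ⟨(((h (c - t)).1.comp_const_sub c t).neg.sub_const (π / 2)).congr_deriv (by
      rw [sin_add_pi_div_two, cos_sub_pi_div_two]; ring),
    (((h (c - t)).2.2.comp_const_sub c t).sub_const (π / 2)).congr_deriv (by
      rw [sin_sub_pi_div_two, cos_neg, cos_add_pi_div_two]; ring),
    (((h (c - t)).2.1.comp_const_sub c t).add_const (π / 2)).congr_deriv (by
      rw [sin_sub_pi_div_two, cos_sub_pi_div_two, sin_neg]; ring)⟩

/-- The reversor of the flow fixing the line `x = π / 4`, `y + z = π / 2`. -/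
theorem reverse_add (h : IsABCSol x y z) (c : ℝ) :
    IsABCSol (fun t => π / 2 - x (c - t)) (fun t => π / 2 - z (c - t))
      (fun t => π / 2 - y (c - t)) := fun t =>
  ⟨(((h (c - t)).1.comp_const_sub c t).const_sub (π / 2)).congr_deriv (by
      rw [sin_pi_div_two_sub, cos_pi_div_two_sub]; ring),
    (((h (c - t)).2.2.comp_const_sub c t).const_sub (π / 2)).congr_deriv (by
      rw [sin_pi_div_two_sub, cos_pi_div_two_sub]; ring),
    (((h (c - t)).2.1.comp_const_sub c t).const_sub (π / 2)).congr_deriv (by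
      rw [sin_pi_div_two_sub, cos_pi_div_two_sub]; ring)⟩

/-- An orbit joining the fixed lines of the two reversors advances by `2π` in `x`. -/
theorem translate_of_meets (h : IsABCSol x y z) (hx0 : x 0 = -(π / 4)) (hz0 : z 0 = y 0 + π / 2)
    {T : ℝ} (hxT : x T = π / 4) (hyzT : y T + z T = π / 2) (t : ℝ) :
    x (t + 4 * T) = x t + 2 * π ∧ y (t + 4 * T) = y t ∧ z (t + 4 * T) = z t := by
  have hsub := h.eq_of_eq_at (h.reverse_sub 0) (t₀ := 0) (by simp [hx0]; ring) (by simp [hz0])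
    (by simp [hz0])
  have hTT : 2 * T - T = T := by ring
  have hadd := h.eq_of_eq_at (h.reverse_add (2 * T)) (t₀ := T) (by simp only [hTT, hxT]; ring)
    (by simp only [hTT]; linarith) (by simp only [hTT]; linarith)
  have hhalf : ∀ t, x (t + 2 * T) = x t + π ∧ y (t + 2 * T) = -y t ∧
      z (t + 2 * T) = π - z t := by
    intro t
    obtain ⟨hx, hy, hz⟩ := hadd (t + 2 * T)
    obtain ⟨hx', hy', hz'⟩ := hsub t
    simp only [zero_sub, show 2 * T - (t + 2 * T) = -t by ring] at hx hy hz hx' hy' hz'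
    refine ⟨?_, ?_, ?_⟩ <;> linarith
  obtain ⟨hx, hy, hz⟩ := hhalf (t + 2 * T)
  obtain ⟨hx', hy', hz'⟩ := hhalf t
  rw [show t + 4 * T = t + 2 * T + 2 * T by ring]
  refine ⟨?_, ?_, ?_⟩ <;> linarith

theorem isReducedSol (h : IsABCSol x y z) :
    IsReducedSol (fun t => x t + π / 4) (fun t => (y t + z t - π / 2) / 2)
      (fun t => (z t - y t - π / 2) / 2) := by
  intro t
  set p := (y t + z t - π / 2) / 2 with hp
  set q := (z t - y t - π / 2) / 2 with hq
  have hy : y t = p - q := by rw [hp, hq]; ring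
  have hz : z t = p + q + π / 2 := by rw [hp, hq]; ring
  have hsq : √2 * √2 = 2 := Real.mul_self_sqrt (by norm_num)
  refine ⟨((h t).1.add_const _).congr_deriv ?_,
    ((((h t).2.1.add (h t).2.2).sub_const _).div_const 2).congr_deriv ?_,
    ((((h t).2.2.sub (h t).2.1).sub_const _).div_const 2).congr_deriv ?_⟩
  · rw [hy, hz, sin_add_pi_div_two, cos_add, cos_sub]
    ring
  · rw [hy, hz, cos_add_pi_div_two, sin_add p q, sin_sub p q, sin_add (x t), sin_pi_div_four,
      cos_pi_div_four]
    linear_combination (-(1 / 4) * (sin (x t) + cos (x t))) * hsq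
  · rw [hy, hz, cos_add_pi_div_two, sin_add p q, sin_sub p q, cos_add (x t), sin_pi_div_four,
      cos_pi_div_four]
    linear_combination (-(1 / 4) * (cos (x t) - sin (x t))) * hsq

end IsABCSol

/-- The ABC flow has an orbit that is translated by `v` over some positive time. -/
def HasABCOrbitAlong (v : ℝ × ℝ × ℝ) : Prop :=
  ∃ t₀ > (0 : ℝ), ∃ x y z : ℝ → ℝ, IsABCSol x y z ∧
    ∀ t : ℝ, x (t + t₀) = x t + v.1 ∧ y (t + t₀) = y t + v.2.1 ∧ z (t + t₀) = z t + v.2.2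

namespace HasABCOrbitAlong

theorem cycle {a b c : ℝ} : HasABCOrbitAlong (a, b, c) → HasABCOrbitAlong (b, c, a) := by
  rintro ⟨t₀, ht₀, x, y, z, h, htr⟩
  exact ⟨t₀, ht₀, y, z, x, h.cycle, fun t => ⟨(htr t).2.1, (htr t).2.2, (htr t).1⟩⟩

theorem half_turn {a b c : ℝ} : HasABCOrbitAlong (a, b, c) → HasABCOrbitAlong (-a, -b, c) := by
  rintro ⟨t₀, ht₀, x, y, z, h, htr⟩
  refine ⟨t₀, ht₀, _, _, _, h.half_turn, fun t => ?_⟩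
  obtain ⟨hx, hy, hz⟩ := htr t
  simp only at hx hy hz ⊢
  refine ⟨?_, ?_, ?_⟩ <;> linarith

end HasABCOrbitAlong

theorem hasABCOrbitAlong_x : HasABCOrbitAlong (2 * π, 0, 0) := by
  choose φ hφ0 hφ using fun a : ℝ => exists_hasDerivAt_of_lipschitzWith_of_norm_le
    lipschitzWith_abcField (L := 2) norm_abcField_le (-(π / 4), a, a + π / 2)
  have hsol := fun a => IsABCSol.of_hasDerivAt (hφ a)
  have hcont : ∀ a, Continuous (φ a) := fun a =>
    continuous_iff_continuousAt.2 fun t => (hφ a t).continuousAt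
  have hunif : ∀ a T, TendstoUniformlyOn φ (φ a) (nhds a) (Icc 0 T) := by
    intro a T
    rw [Metric.tendstoUniformlyOn_iff]
    intro ε hε
    filter_upwards [Metric.ball_mem_nhds a (div_pos hε (exp_pos (2 * T)))] with b hb t ht
    have hab : dist (φ a 0) (φ b 0) ≤ dist a b := by simp [hφ0, Prod.dist_eq]
    have hgron := dist_le_of_trajectories_ODE (v := fun _ => abcField) (K := 2) (a := 0) (b := T)
      (fun _ => lipschitzWith_abcField) (hcont a).continuousOn
      (fun t _ => (hφ a t).hasDerivWithinAt) (hcont b).continuousOn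
      (fun t _ => (hφ b t).hasDerivWithinAt) hab t ht
    rw [Metric.mem_ball', lt_div_iff₀ (exp_pos _)] at hb
    refine (hgron.trans ?_).trans_lt hb
    gcongr
    · simpa using ht.1
    · simp
    · linarith [ht.2]
  have hs_unif : UniformContinuous fun X : ℝ × ℝ × ℝ => X.1 + π / 4 :=
    uniformContinuous_fst.add uniformContinuous_const
  have hp_unif : UniformContinuous fun X : ℝ × ℝ × ℝ => (X.2.1 + X.2.2 - π / 2) / 2 :=
    (((uniformContinuous_fst.comp uniformContinuous_snd).add
      (uniformContinuous_snd.comp uniformContinuous_snd)).sub uniformContinuous_const).div_const' (2 : ℝ)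
  obtain ⟨a, T, hT, hsT, hpT⟩ := exists_reducedSol_meets (fun a => (hsol a).isReducedSol)
    (fun a => by simp [hφ0]) (fun a => by simp only [hφ0]; ring) (fun a => by simp [hφ0])
    (fun a T => hs_unif.comp_tendstoUniformlyOn (hunif a T))
    (fun a T => hp_unif.comp_tendstoUniformlyOn (hunif a T))
  refine ⟨4 * T, by positivity, _, _, _, hsol a, fun t => ?_⟩
  simpa using (hsol a).translate_of_meets (by simp [hφ0]) (by simp [hφ0]) (T := T)
    (by linarith) (by linarith) t

theorem stmt2 (v : ℝ × ℝ × ℝ)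
    (hv : v = (2 * π, 0, 0) ∨ v = (0, 2 * π, 0) ∨ v = (0, 0, 2 * π) ∨
          v = (-(2 * π), 0, 0) ∨ v = (0, -(2 * π), 0) ∨ v = (0, 0, -(2 * π))) :
    ∃ t₀ > (0 : ℝ), ∃ x y z : ℝ → ℝ, IsABCSol x y z ∧
      ∀ t : ℝ, x (t + t₀) = x t + v.1 ∧ y (t + t₀) = y t + v.2.1 ∧
        z (t + t₀) = z t + v.2.2 := by
  have hpos := hasABCOrbitAlong_x
  have hneg : HasABCOrbitAlong (-(2 * π), 0, 0) := by simpa using hpos.half_turn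
  rcases hv with rfl | rfl | rfl | rfl | rfl | rfl
  · exact hpos
  · exact hpos.cycle.cycle
  · exact hpos.cycle
  · exact hneg
  · exact hneg.cycle.cycle
  · exact hneg.cycle
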